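/- Let n ≥ 2, and for each r ∈ {1,…,n} let B_r be an (n-1)×(n-1) symmetric positive semi-definite matrix. Define A_r as the n×n matrix whose (i,j) entry is π when i = r or j = r, and whose remaining (n-1)×(n-1) principal submatrix (rows and columns ≠ r) is B_r. Then for every v ∈ ℝ^n, v' (Σ_{r=1}^n A_r + π I_n) v = Σ_{r=1}^n v_{-r}' B_r v_{-r} + 2π (Σ_{j=1}^n v_j)², and consequently Σ_{r=1}^n A_r + π I_n is positive semi-definite. -/

import Mathlib

open Matrix

/-- The quadratic form of a matrix whose `r`-th row and column are constant, split off along `r`. -/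
theorem dotProduct_mulVec_of_const_row_col {R : Type*} [CommRing R] {n : ℕ} {r : Fin (n + 1)}
    {c : R} {A : Matrix (Fin (n + 1)) (Fin (n + 1)) R} {B : Matrix (Fin n) (Fin n) R}
    (hc : ∀ i j, (i = r ∨ j = r) → A i j = c)
    (hB : ∀ k l, A (r.succAbove k) (r.succAbove l) = B k l) (v : Fin (n + 1) → R) :
    v ⬝ᵥ A.mulVec v =
      (fun k => v (r.succAbove k)) ⬝ᵥ B.mulVec (fun k => v (r.succAbove k))
        + c * (2 * v r * (∑ j, v j) - v r ^ 2) := by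
  have hrow : ∀ j, A r j = c := fun j => hc r j (Or.inl rfl)
  have hcol : ∀ i, A i r = c := fun i => hc i r (Or.inr rfl)
  simp only [dotProduct, mulVec, Fin.sum_univ_succAbove _ r, hrow, hcol, hB, mul_add,
    Finset.sum_add_distrib, ← Finset.mul_sum, ← Finset.sum_mul]
  ring

/-- A matrix whose `r`-th row and column are constant is symmetric if the complementary
principal submatrix is. -/
theorem isSymm_of_const_row_col {R : Type*} {n : ℕ} {r : Fin (n + 1)}
    {c : R} {A : Matrix (Fin (n + 1)) (Fin (n + 1)) R} {B : Matrix (Fin n) (Fin n) R}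
    (hc : ∀ i j, (i = r ∨ j = r) → A i j = c)
    (hB : ∀ k l, A (r.succAbove k) (r.succAbove l) = B k l) (hs : B.IsSymm) : A.IsSymm := by
  refine IsSymm.ext fun i j => ?_
  rcases Fin.eq_self_or_eq_succAbove r i with rfl | ⟨k, rfl⟩
  · rw [hc _ _ (Or.inr rfl), hc _ _ (Or.inl rfl)]
  rcases Fin.eq_self_or_eq_succAbove r j with rfl | ⟨l, rfl⟩
  · rw [hc _ _ (Or.inl rfl), hc _ _ (Or.inr rfl)]
  · rw [hB, hB, hs.apply]

/-- Key algebraic decomposition: with `A_r` having `π` in row/column `r` and the symmetric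
positive semi-definite `B_r` elsewhere, `v'(Σ_r A_r + πI)v = Σ_r v_{-r}'B_r v_{-r} +
2π(Σ_j v_j)²`, hence `Σ_r A_r + πI` is positive semi-definite. (`n + 1 ≥ 2` points.) -/
theorem stmt10 (n : ℕ) (hn : 1 ≤ n)
    (B : Fin (n + 1) → Matrix (Fin n) (Fin n) ℝ)
    (hB : ∀ r, (B r).PosSemidef)
    (A : Fin (n + 1) → Matrix (Fin (n + 1)) (Fin (n + 1)) ℝ)
    (hAπ : ∀ r i j, (i = r ∨ j = r) → A r i j = Real.pi)
    (hAB : ∀ r k l, A r (r.succAbove k) (r.succAbove l) = B r k l) :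
    (∀ v : Fin (n + 1) → ℝ,
      v ⬝ᵥ ((∑ r, A r) + Real.pi • (1 : Matrix (Fin (n + 1)) (Fin (n + 1)) ℝ)).mulVec v =
        (∑ r, (fun k => v (r.succAbove k)) ⬝ᵥ (B r).mulVec (fun k => v (r.succAbove k)))
          + 2 * Real.pi * (∑ j, v j) ^ 2) ∧
      ((∑ r, A r) + Real.pi • (1 : Matrix (Fin (n + 1)) (Fin (n + 1)) ℝ)).PosSemidef := by
  have key : ∀ v : Fin (n + 1) → ℝ,
      v ⬝ᵥ ((∑ r, A r) + Real.pi • (1 : Matrix (Fin (n + 1)) (Fin (n + 1)) ℝ)).mulVec v =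
        (∑ r, (fun k => v (r.succAbove k)) ⬝ᵥ (B r).mulVec (fun k => v (r.succAbove k)))
          + 2 * Real.pi * (∑ j, v j) ^ 2 := by
    intro v
    have hv : v ⬝ᵥ v = ∑ r, v r ^ 2 := by simp only [dotProduct, sq]
    rw [add_mulVec, dotProduct_add, sum_mulVec, dotProduct_sum, smul_mulVec, one_mulVec,
      dotProduct_smul, hv, Finset.sum_congr rfl fun r _ =>
        dotProduct_mulVec_of_const_row_col (hAπ r) (hAB r) v, Finset.sum_add_distrib,
      ← Finset.mul_sum, Finset.sum_sub_distrib, ← Finset.sum_mul, ← Finset.mul_sum, smul_eq_mul]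
    ring
  refine ⟨key, PosSemidef.of_dotProduct_mulVec_nonneg ?_ fun v => ?_⟩
  · have hA : ∀ r, (A r).IsSymm := fun r =>
      isSymm_of_const_row_col (hAπ r) (hAB r) (by simpa using (hB r).isHermitian)
    rw [IsHermitian, conjTranspose_eq_transpose_of_trivial, transpose_add, transpose_sum,
      transpose_smul, transpose_one, Finset.sum_congr rfl fun r _ => hA r]
  · rw [star_trivial, key]
    have hnonneg := Finset.sum_nonneg fun r (_ : r ∈ Finset.univ) =>
      (hB r).dotProduct_mulVec_nonneg fun k => v (r.succAbove k)
    simp only [star_trivial] at hnonneg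
    have := Real.pi_pos
    positivity
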